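/- Let X be an alphabet having n ≥ 2 letters and define A(n) = ⌊9n³√(n log n)⌋. Let g, h: X* → X* be primitive morphisms and let x ∈ X be a letter such that g^ω(x) and h^ω(x) exist. Assume that g is loop-free, BAL(g, h) < ∞ and M_h ≤ M_g². Then g^ω(x) = h^ω(x) if and only if g^{A(n)}(x) ∈ COMP(g, h). -/

import Mathlib

open Filter Set

variable {X : Type*}

/-- Apply the morphism with letter images `g` to a word. -/
def applyM (g : X → List X) (w : List X) : List X := w.flatMap g

/-- `iterM g k w` is `g^k(w)`. -/
def iterM (g : X → List X) (k : ℕ) (w : List X) : List X := (applyM g)^[k] w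

/-- The letter map of the composition `g ∘ h` (first `h`, then `g`). -/
def compM (g h : X → List X) : X → List X := fun a => applyM g (h a)

/-- The letter map of the power `g^k`. -/
def powM (g : X → List X) (k : ℕ) : X → List X := fun a => iterM g k [a]

/-- A morphism is primitive if some power maps every letter to a word containing every letter. -/
def Primitive (g : X → List X) : Prop := ∃ k : ℕ, 0 < k ∧ ∀ a b : X, a ∈ iterM g k [b]

/-- `Mg g` is the maximal length of the image of a letter. -/
def Mg [Fintype X] (g : X → List X) : ℕ := Finset.univ.sup fun x => (g x).length

/-- A morphism is growing if the lengths of iterated images of every letter tend to infinity. -/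
def Growing (g : X → List X) : Prop :=
  ∀ x : X, Tendsto (fun i => (iterM g i [x]).length) atTop atTop

/-- `w` is a (finite) prefix of the infinite word `s`. -/
def IsPrefI (w : List X) (s : ℕ → X) : Prop := ∀ i (h : i < w.length), w[i]'h = s i

/-- `v` is a factor of the infinite word `s`. -/
def IsFactorI (v : List X) (s : ℕ → X) : Prop :=
  ∃ j : ℕ, ∀ i (h : i < v.length), v[i]'h = s (j + i)

/-- `g^ω(x)` exists. -/
def OmegaExists (g : X → List X) (x : X) : Prop :=
  [x] <+: g x ∧ Tendsto (fun i => (iterM g i [x]).length) atTop atTop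

/-- `s = g^ω(x)`. -/
def IsOmega (g : X → List X) (x : X) (s : ℕ → X) : Prop :=
  OmegaExists g x ∧ ∀ i : ℕ, IsPrefI (iterM g i [x]) s

/-- `s = u^ω` for the nonempty word `u`. -/
def IsPeriodicWord (s : ℕ → X) (u : List X) : Prop :=
  u ≠ [] ∧ ∀ (i : ℕ) (h : i % u.length < u.length), s i = u[i % u.length]'h

/-- A morphism is looping. -/
def Looping (g : X → List X) : Prop :=
  ∃ k : ℕ, 0 < k ∧ ∃ x : X, ∃ u : List X, ∃ s : ℕ → X,
    IsOmega (powM g k) x s ∧ IsPeriodicWord s u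

/-- A morphism is loop-free if it is not looping. -/
def LoopFree (g : X → List X) : Prop := ¬ Looping g

/-- `p` is a period of `u`. -/
def HasPeriod (u : List X) (p : ℕ) : Prop :=
  0 < p ∧ ∀ i : ℕ, i + p < u.length → u[i + p]? = u[i]?

/-- The smallest period of `u`. -/
noncomputable def PER (u : List X) : ℕ := sInf {p | HasPeriod u p}

/-- A primitive word: nonempty and not a proper power of a shorter word. -/
def PrimitiveWord (u : List X) : Prop :=
  u ≠ [] ∧ ¬∃ (v : List X) (j : ℕ), 2 ≤ j ∧ v.length < u.length ∧
    u = (List.replicate j v).flatten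

/-- `COMP g h` : the set of words whose images under `g` and `h` are prefix-comparable. -/
def COMP (g h : X → List X) : Set (List X) :=
  {w | ∃ u₁ u₂ : List X, applyM g w ++ u₁ = applyM h w ++ u₂}

/-- `BAL g h`. -/
noncomputable def BAL (g h : X → List X) : ℕ∞ :=
  ⨆ (x : X) (k : ℕ),
    ((((applyM g (iterM g k [x])).length : ℤ) -
      ((applyM h (iterM g k [x])).length : ℤ)).natAbs : ℕ∞)

/-- The set of factors of length `q` of the word `w`. -/
def Fq (q : ℕ) (w : List X) : Set (List X) := {v | v.length = q ∧ v <:+: w}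

/-- The set of factors of length `q` of words of `L`. -/
def FqL (q : ℕ) (L : Set (List X)) : Set (List X) := ⋃ w ∈ L, Fq q w

/-- `A n = ⌊9 n³ √(n log n)⌋`. -/
noncomputable def Abound (n : ℕ) : ℕ := ⌊9 * (n : ℝ)^3 * Real.sqrt (n * Real.log n)⌋₊

theorem applyM_append (g : X → List X) (u v : List X) :
    applyM g (u ++ v) = applyM g u ++ applyM g v := by
  simp [applyM]

theorem applyM_nil (g : X → List X) : applyM g [] = [] := rfl

theorem applyM_cons (g : X → List X) (a : X) (v : List X) :
    applyM g (a :: v) = g a ++ applyM g v := by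
  simp [applyM]

theorem applyM_single (g : X → List X) (a : X) : applyM g [a] = g a := by
  simp [applyM]

theorem iterM_zero (g : X → List X) (w : List X) : iterM g 0 w = w := rfl

theorem iterM_succ (g : X → List X) (k : ℕ) (w : List X) :
    iterM g (k + 1) w = iterM g k (applyM g w) := rfl

theorem iterM_succ' (g : X → List X) (k : ℕ) (w : List X) :
    iterM g (k + 1) w = applyM g (iterM g k w) := by
  simp only [iterM, Function.iterate_succ_apply']

theorem iterM_add (g : X → List X) (j k : ℕ) (w : List X) :
    iterM g (j + k) w = iterM g j (iterM g k w) := by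
  simp only [iterM, Function.iterate_add_apply]

theorem iterM_append (g : X → List X) (k : ℕ) (u v : List X) :
    iterM g k (u ++ v) = iterM g k u ++ iterM g k v := by
  induction k generalizing u v with
  | zero => rfl
  | succ k ih => rw [iterM_succ, iterM_succ, iterM_succ, applyM_append, ih]

theorem iterM_nil (g : X → List X) (k : ℕ) : iterM g k [] = [] := by
  induction k with
  | zero => rfl
  | succ k ih => rw [iterM_succ, applyM_nil, ih]

theorem applyM_powM (g : X → List X) (k : ℕ) (w : List X) :
    applyM (powM g k) w = iterM g k w := by
  induction w with
  | nil => rw [applyM_nil, iterM_nil]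
  | cons a w ih =>
    rw [applyM_cons, ih, show a :: w = [a] ++ w from rfl, iterM_append]; rfl

theorem applyM_infix (g : X → List X) {u v : List X} (h : u <:+: v) :
    applyM g u <:+: applyM g v := by
  obtain ⟨s, t, rfl⟩ := h
  exact ⟨applyM g s, applyM g t, by simp [applyM_append]⟩

theorem iterM_infix (g : X → List X) (k : ℕ) {u v : List X} (h : u <:+: v) :
    iterM g k u <:+: iterM g k v := by
  rw [← applyM_powM, ← applyM_powM]; exact applyM_infix _ h

theorem applyM_prefix (g : X → List X) {u v : List X} (h : u <+: v) :
    applyM g u <+: applyM g v := by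
  obtain ⟨t, rfl⟩ := h
  exact ⟨applyM g t, by simp [applyM_append]⟩

theorem iterM_prefix (g : X → List X) (k : ℕ) {u v : List X} (h : u <+: v) :
    iterM g k u <+: iterM g k v := by
  rw [← applyM_powM, ← applyM_powM]; exact applyM_prefix _ h

theorem single_infix {a : X} {w : List X} (h : a ∈ w) : [a] <:+: w := by
  obtain ⟨s, t, rfl⟩ := List.append_of_mem h
  exact ⟨s, t, by simp⟩

theorem Primitive.nonerasing {g : X → List X} (hg : Primitive g) (a : X) : g a ≠ [] := by
  intro h
  obtain ⟨k, hk, H⟩ := hg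
  obtain ⟨k, rfl⟩ := Nat.exists_eq_succ_of_ne_zero hk.ne'
  have := H a a
  rw [Nat.succ_eq_add_one, iterM_succ, applyM_single, h, iterM_nil] at this
  simp at this

theorem Primitive.one_le {g : X → List X} (hg : Primitive g) (a : X) : 1 ≤ (g a).length :=
  List.length_pos_iff.2 (hg.nonerasing a)

/-- Lower bound on the length of an image. -/
theorem length_applyM_ge {f : X → List X} {l : ℕ} (hf : ∀ z, l ≤ (f z).length) (w : List X) :
    w.length * l ≤ (applyM f w).length := by
  induction w with
  | nil => simp
  | cons a w ih =>
    rw [applyM_cons, List.length_append, List.length_cons, Nat.add_mul, one_mul]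
    have := hf a
    omega

theorem length_applyM_le {f : X → List X} {l : ℕ} (hf : ∀ z, (f z).length ≤ l) (w : List X) :
    (applyM f w).length ≤ w.length * l := by
  induction w with
  | nil => simp [applyM_nil]
  | cons a w ih =>
    rw [applyM_cons, List.length_append, List.length_cons, Nat.add_mul, one_mul]
    have := hf a
    omega

theorem length_iterM_mono {g : X → List X} (hg : Primitive g) {j k : ℕ} (hjk : j ≤ k)
    (w : List X) : (iterM g j w).length ≤ (iterM g k w).length := by
  induction k, hjk using Nat.le_induction with
  | base => exact le_rfl
  | succ k _ ih =>
    rw [iterM_succ']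
    have := length_applyM_ge hg.one_le (iterM g k w)
    omega

theorem le_Mg [Fintype X] (g : X → List X) (a : X) : (g a).length ≤ Mg g :=
  Finset.le_sup (f := fun x => (g x).length) (Finset.mem_univ a)

theorem length_iterM_le [Fintype X] (g : X → List X) (k : ℕ) (w : List X) :
    (iterM g k w).length ≤ w.length * Mg g ^ k := by
  induction k with
  | zero => simp [iterM_zero]
  | succ k ih =>
    rw [iterM_succ', pow_succ, ← mul_assoc]
    exact (length_applyM_le (le_Mg g) _).trans (Nat.mul_le_mul_right _ ih)

theorem mem_applyM {g : X → List X} {w : List X} {b : X} :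
    b ∈ applyM g w ↔ ∃ a ∈ w, b ∈ g a := by
  simp [applyM]

/-- Reachability of every letter in at most `n - 1` steps. -/
theorem reach [Fintype X] {g : X → List X} (hg : Primitive g) (y z : X) :
    ∃ j ≤ Fintype.card X - 1, z ∈ iterM g j [y] := by
  classical
  let R : ℕ → Finset X := fun i => Finset.univ.filter fun z => ∃ j ≤ i, z ∈ iterM g j [y]
  have hR : ∀ i z, z ∈ R i ↔ ∃ j ≤ i, z ∈ iterM g j [y] := by intro i z; simp [R]
  have hmono : ∀ i, R i ⊆ R (i + 1) := by
    intro i z hz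
    rw [hR] at hz ⊢
    obtain ⟨j, hj, h⟩ := hz
    exact ⟨j, by omega, h⟩
  have hmono' : Monotone R := monotone_nat_of_le_succ hmono
  have h0 : y ∈ R 0 := by rw [hR]; exact ⟨0, le_rfl, by simp [iterM_zero]⟩
  have hpos : ∀ i, 1 ≤ (R i).card := fun i =>
    Finset.card_pos.2 ⟨y, hmono' (Nat.zero_le i) h0⟩
  obtain ⟨k, hk, H⟩ := hg
  have h3 := Nat.stabilises_of_monotone (f := fun i => (R i).card - 1)
    (b := Fintype.card X - 1) (n := k + (Fintype.card X - 1))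
    (fun a b hab => Nat.sub_le_sub_right (Finset.card_le_card (hmono' hab)) 1)
    (fun m => Nat.sub_le_sub_right (Finset.card_le_univ _) 1)
    (by
      intro m hm
      have h1 := hpos m
      have h2 := hpos (m + 1)
      have heq : R m = R (m + 1) := Finset.eq_of_subset_of_card_le (hmono m) (by omega)
      have : R (m + 1) = R (m + 2) := by
        apply Finset.Subset.antisymm (hmono _)
        intro z hz
        rw [hR] at hz
        obtain ⟨j, hj, hz⟩ := hz
        rcases j with _ | j
        · rw [hR]; exact ⟨0, by omega, hz⟩
        rw [iterM_succ', mem_applyM] at hz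
        obtain ⟨a, ha, hz⟩ := hz
        have : a ∈ R (m + 1) := by rw [hR]; exact ⟨j, by omega, ha⟩
        rw [← heq, hR] at this
        obtain ⟨i, hi, ha⟩ := this
        rw [hR]
        exact ⟨i + 1, by omega, by rw [iterM_succ', mem_applyM]; exact ⟨a, ha, hz⟩⟩
      simp only [this])
    (by omega)
  have hz : z ∈ R (k + (Fintype.card X - 1)) := by rw [hR]; exact ⟨k, by omega, H z y⟩
  have heq : R (Fintype.card X - 1) = R (k + (Fintype.card X - 1)) :=
    Finset.eq_of_subset_of_card_le (hmono' (by omega)) (by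
      have h1 := hpos (Fintype.card X - 1)
      have h2 := hpos (k + (Fintype.card X - 1))
      omega)
  rw [← heq, hR] at hz
  exact hz

/-- Maximal and minimal growth are comparable. -/
theorem length_cmp [Fintype X] {g : X → List X} (hg : Primitive g) (k : ℕ) (y z : X) :
    (iterM g k [z]).length ≤ (iterM g (k + (Fintype.card X - 1)) [y]).length := by
  obtain ⟨j, hj, hz⟩ := reach hg y z
  refine le_trans ?_ (length_iterM_mono hg (show k + j ≤ _ by omega) [y])
  rw [iterM_add]
  exact (iterM_infix g k (single_infix hz)).length_le

theorem growth_step [Fintype X] {g : X → List X} (hg : Primitive g) (y : X) :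
    Mg g ≤ (iterM g (Fintype.card X) [y]).length := by
  have : Nonempty X := ⟨y⟩
  obtain ⟨a, -, ha⟩ := Finset.exists_mem_eq_sup (Finset.univ : Finset X)
    Finset.univ_nonempty (fun x => (g x).length)
  have h := length_cmp hg 1 y a
  have hc : 0 < Fintype.card X := Fintype.card_pos
  rw [show 1 + (Fintype.card X - 1) = Fintype.card X by omega, iterM_succ, iterM_zero,
    applyM_single] at h
  rw [Mg, ha]; exact h

theorem growth_mul [Fintype X] {g : X → List X} (hg : Primitive g) {k l : ℕ}
    (hl : ∀ z, l ≤ (iterM g k [z]).length) (a : ℕ) (y : X) :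
    Mg g ^ a * l ≤ (iterM g (k + Fintype.card X * a) [y]).length := by
  induction a generalizing y with
  | zero => simpa using hl y
  | succ a ih =>
    have h1 := growth_step hg y
    have h2 := length_applyM_ge (f := powM g (k + Fintype.card X * a)) ih
      (iterM g (Fintype.card X) [y])
    rw [applyM_powM, ← iterM_add] at h2
    rw [show k + Fintype.card X * (a + 1) = k + Fintype.card X * a + Fintype.card X by ring]
    refine le_trans ?_ h2
    rw [pow_succ, mul_comm (Mg g ^ a), mul_assoc]
    exact Nat.mul_le_mul_right _ h1

section Orbit

/-- Bounded orbit. -/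
def BddOrbit {E : Type*} [NormedAddCommGroup E] [NormedSpace ℂ E] (T : Module.End ℂ E) (v : E) :
    Prop := ∃ B : ℝ, ∀ k : ℕ, ‖(T ^ k) v‖ ≤ B

/-- Product of the factors `T - c`. -/
noncomputable def facProd {E : Type*} [NormedAddCommGroup E] [NormedSpace ℂ E]
    (T : Module.End ℂ E) (ls : List ℂ) : Module.End ℂ E :=
  (ls.map fun c => T - c • (1 : Module.End ℂ E)).prod

theorem facProd_cons {E : Type*} [NormedAddCommGroup E] [NormedSpace ℂ E]
    (T : Module.End ℂ E) (c : ℂ) (ls : List ℂ) :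
    facProd T (c :: ls) = (T - c • (1 : Module.End ℂ E)) * facProd T ls := by
  simp [facProd]

theorem facProd_comm {E : Type*} [NormedAddCommGroup E] [NormedSpace ℂ E]
    (T : Module.End ℂ E) (c : ℂ) (ls : List ℂ) :
    Commute (T - c • (1 : Module.End ℂ E)) (facProd T ls) := by
  apply Commute.list_prod_right
  intro y hy
  simp only [List.mem_map] at hy
  obtain ⟨d, -, rfl⟩ := hy
  have h1 : ∀ c : ℂ, Commute T (c • (1 : Module.End ℂ E)) := fun c =>
    (Commute.one_right T).smul_right c
  have h2 : Commute (c • (1 : Module.End ℂ E)) (d • (1 : Module.End ℂ E)) :=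
    ((Commute.one_right _).smul_right d)
  exact ((Commute.refl T).sub_right (h1 d)).sub_left ((h1 c).symm.sub_right h2)

theorem pow_sub_apply {E : Type*} [NormedAddCommGroup E] [NormedSpace ℂ E]
    (T : Module.End ℂ E) (c : ℂ) (v : E) (k : ℕ) :
    (T ^ k) ((T - c • (1 : Module.End ℂ E)) v) = (T ^ (k + 1)) v - c • (T ^ k) v := by
  simp [pow_succ]

theorem BddOrbit.sub {E : Type*} [NormedAddCommGroup E] [NormedSpace ℂ E]
    {T : Module.End ℂ E} {v : E} (h : BddOrbit T v) (c : ℂ) :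
    BddOrbit T ((T - c • (1 : Module.End ℂ E)) v) := by
  obtain ⟨B, hB⟩ := h
  refine ⟨B + ‖c‖ * B, fun k => ?_⟩
  rw [pow_sub_apply]
  refine (norm_sub_le _ _).trans (add_le_add (hB _) ?_)
  rw [norm_smul]
  exact mul_le_mul_of_nonneg_left (hB k) (norm_nonneg _)

theorem BddOrbit.facProd {E : Type*} [NormedAddCommGroup E] [NormedSpace ℂ E]
    {T : Module.End ℂ E} {v : E} (h : BddOrbit T v) (ls : List ℂ) :
    BddOrbit T (facProd T ls v) := by
  induction ls with
  | nil => simpa [_root_.facProd] using h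
  | cons c ls ih =>
    rw [facProd_cons]
    exact ih.sub c

theorem orbit_bound {E : Type*} [NormedAddCommGroup E] [NormedSpace ℂ E]
    (T : Module.End ℂ E) (ls : List ℂ) : ∀ (v : E), BddOrbit T v → facProd T ls v = 0 →
    ∀ D : ℝ, 0 ≤ D → (∀ i < ls.length, ‖(T ^ i) v‖ ≤ D) →
    ∀ k : ℕ, ‖(T ^ k) v‖ ≤ 2 ^ (ls.length - 1) * (1 + (k : ℝ)) ^ (ls.length - 1) * D := by
  induction ls with
  | nil =>
    intro v _ h0 D hD _ k
    have : v = 0 := by simpa [facProd] using h0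
    subst this
    simpa using hD
  | cons c ls ih =>
    intro v hv h0 D hD hi k
    have hk0 : (0 : ℝ) ≤ k := Nat.cast_nonneg k
    simp only [List.length_cons, Nat.add_sub_cancel] at hi ⊢
    rw [facProd_cons] at h0
    by_cases hc : ‖c‖ ≤ 1
    · set u := (T - c • (1 : Module.End ℂ E)) v with hu
      have hu0 : facProd T ls u = 0 := by
        rw [(facProd_comm T c ls).eq] at h0
        exact h0
      have hub := hv.sub c
      have hui : ∀ i < ls.length, ‖(T ^ i) u‖ ≤ 2 * D := by
        intro i hil
        rw [hu, pow_sub_apply]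
        refine (norm_sub_le _ _).trans ?_
        rw [norm_smul]
        have h1 := hi (i + 1) (by omega)
        have h2 := hi i (by omega)
        have h3 : ‖c‖ * ‖(T ^ i) v‖ ≤ 1 * D :=
          mul_le_mul hc h2 (norm_nonneg _) zero_le_one
        linarith
      have hb := ih u hub hu0 (2 * D) (by positivity) hui
      have step : ∀ j, ‖(T ^ (j + 1)) v‖ ≤ ‖(T ^ j) v‖ + ‖(T ^ j) u‖ := by
        intro j
        have h1 : (T ^ (j + 1)) v = c • (T ^ j) v + (T ^ j) u := by
          rw [hu, pow_sub_apply]; abel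
        rw [h1]
        refine (norm_add_le _ _).trans (add_le_add_left ?_ _)
        rw [norm_smul]
        exact mul_le_of_le_one_left (norm_nonneg _) hc
      have hv0 : ‖(T ^ 0) v‖ ≤ D := hi 0 (by omega)
      rcases Nat.eq_zero_or_pos ls.length with hl | hl
      · have hls : ls = [] := List.length_eq_zero_iff.1 hl
        have hu00 : u = 0 := by rw [hls] at hu0; simpa [facProd] using hu0
        have : ∀ j, ‖(T ^ j) v‖ ≤ D := by
          intro j
          induction j with
          | zero => exact hv0
          | succ j ihj =>
            have := step j
            rw [hu00] at this
            simp only [map_zero, norm_zero, add_zero] at this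
            linarith
        rw [hl]
        simpa using this k
      · obtain ⟨m, hm⟩ : ∃ m, ls.length = m + 1 := ⟨ls.length - 1, by omega⟩
        rw [hm] at hb ⊢
        simp only [Nat.add_sub_cancel] at hb
        have hsum : ∀ j ≤ k, ‖(T ^ j) v‖ ≤ D + j * (2 ^ m * (1 + (k : ℝ)) ^ m * (2 * D)) := by
          intro j
          induction j with
          | zero => intro _; simpa using hv0
          | succ j ihj =>
            intro hjk
            have h1 := step j
            have h2 := ihj (by omega)
            have h3 := hb j
            have hjk' : (j : ℝ) ≤ k := by exact_mod_cast (by omega : j ≤ k)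
            have h4 : (2 : ℝ) ^ m * (1 + (j : ℝ)) ^ m * (2 * D)
                ≤ 2 ^ m * (1 + (k : ℝ)) ^ m * (2 * D) := by gcongr
            push_cast
            linarith
        have h5 := hsum k le_rfl
        have h6 : D ≤ 2 ^ m * (1 + (k : ℝ)) ^ m * (2 * D) := by
          have h7 : (1 : ℝ) ≤ 2 ^ m := one_le_pow₀ (by norm_num)
          have h8 : (1 : ℝ) ≤ (1 + (k : ℝ)) ^ m := one_le_pow₀ (by linarith)
          have h9 : (1 : ℝ) ≤ 2 ^ m * (1 + (k : ℝ)) ^ m := one_le_mul_of_one_le_of_one_le h7 h8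
          have h10 : 1 * (2 * D) ≤ 2 ^ m * (1 + (k : ℝ)) ^ m * (2 * D) :=
            mul_le_mul_of_nonneg_right h9 (by positivity)
          linarith
        calc ‖(T ^ k) v‖ ≤ D + k * (2 ^ m * (1 + (k : ℝ)) ^ m * (2 * D)) := h5
          _ ≤ 2 ^ m * (1 + (k : ℝ)) ^ m * (2 * D)
              + k * (2 ^ m * (1 + (k : ℝ)) ^ m * (2 * D)) := by linarith
          _ = 2 ^ (m + 1) * (1 + (k : ℝ)) ^ (m + 1) * D := by ring
    · push Not at hc
      set w := facProd T ls v with hw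
      have hw0 : (T - c • (1 : Module.End ℂ E)) w = 0 := h0
      have hTw : T w = c • w := by
        have : T w - c • w = 0 := by simpa using hw0
        exact sub_eq_zero.1 this
      have hTk : ∀ k : ℕ, (T ^ k) w = c ^ k • w := by
        intro k
        induction k with
        | zero => simp
        | succ k ihk =>
          rw [pow_succ', Module.End.mul_apply, ihk, map_smul, hTw, smul_smul, ← pow_succ]
      have hwz : w = 0 := by
        by_contra hne
        obtain ⟨B, hB⟩ := hv.facProd ls
        have hpos : 0 < ‖w‖ := norm_pos_iff.2 hne
        obtain ⟨N, hN⟩ := pow_unbounded_of_one_lt (B / ‖w‖) hc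
        have h1 := hB N
        rw [← hw, hTk, norm_smul, norm_pow] at h1
        rw [div_lt_iff₀ hpos] at hN
        linarith
      have h2 := ih v hv hwz D hD (fun i h => hi i (by omega)) k
      refine h2.trans ?_
      have h7 : (2 : ℝ) ^ (ls.length - 1) ≤ 2 ^ ls.length :=
        pow_le_pow_right₀ (by norm_num) (by omega)
      have h8 : (1 + (k : ℝ)) ^ (ls.length - 1) ≤ (1 + (k : ℝ)) ^ ls.length :=
        pow_le_pow_right₀ (by linarith) (by omega)
      gcongr

theorem exists_facProd {E : Type*} [NormedAddCommGroup E] [NormedSpace ℂ E]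
    [FiniteDimensional ℂ E] (T : Module.End ℂ E) :
    ∃ ls : List ℂ, ls.length = Module.finrank ℂ E ∧ facProd T ls = 0 := by
  have hs := IsAlgClosed.splits (LinearMap.charpoly T)
  refine ⟨(LinearMap.charpoly T).roots.toList, ?_, ?_⟩
  · rw [Multiset.length_toList, ← hs.natDegree_eq_card_roots, LinearMap.charpoly_natDegree]
  · have h1 := hs.eq_prod_roots
    rw [(LinearMap.charpoly_monic T).leadingCoeff, Polynomial.C_1, one_mul] at h1
    have h2 := LinearMap.aeval_self_charpoly T
    rw [h1, ← Multiset.coe_toList (LinearMap.charpoly T).roots, Multiset.map_coe,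
      Multiset.prod_coe, map_list_prod, List.map_map] at h2
    rw [← h2, facProd]
    congr 1
    apply List.map_congr_left
    intro a _
    simp [Algebra.algebraMap_eq_smul_one]

end Orbit

/-- Balance of a word. -/
def bet (g h : X → List X) (w : List X) : ℤ :=
  ((applyM g w).length : ℤ) - ((applyM h w).length : ℤ)

theorem bet_append (g h : X → List X) (u v : List X) :
    bet g h (u ++ v) = bet g h u + bet g h v := by
  simp only [bet, applyM_append, List.length_append]; push_cast; ring

/-- The linear map dual to the incidence matrix of `g`. -/
noncomputable def incT (g : X → List X) : Module.End ℂ (X → ℂ) where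
  toFun v := fun y => ((g y).map v).sum
  map_add' u v := by
    funext y
    simp only [Pi.add_apply]
    rw [← List.sum_map_add]; rfl
  map_smul' c v := by
    funext y
    simp only [Pi.smul_apply, smul_eq_mul, RingHom.id_apply]
    rw [← List.sum_map_mul_left]; rfl

theorem sum_incT (g : X → List X) (v : X → ℂ) (w : List X) :
    (w.map (incT g v)).sum = ((applyM g w).map v).sum := by
  induction w with
  | nil => simp [applyM_nil]
  | cons a w ih => rw [applyM_cons, List.map_append, List.sum_append, ← ih]; simp [incT]

theorem sum_incT_pow (g : X → List X) (v : X → ℂ) (k : ℕ) (w : List X) :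
    (w.map ((incT g ^ k) v)).sum = ((iterM g k w).map v).sum := by
  induction k generalizing w with
  | zero => simp [iterM_zero]
  | succ k ih =>
    rw [pow_succ', Module.End.mul_apply, sum_incT, ih, iterM_succ]

theorem sum_bet (g h : X → List X) (w : List X) :
    (w.map (fun y => ((bet g h [y] : ℤ) : ℂ))).sum = ((bet g h w : ℤ) : ℂ) := by
  induction w with
  | nil => simp [bet, applyM_nil]
  | cons a w ih =>
    rw [show a :: w = [a] ++ w from rfl, bet_append]
    simp [ih]

theorem incT_pow_bet (g h : X → List X) (k : ℕ) (y : X) :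
    (incT g ^ k) (fun y => ((bet g h [y] : ℤ) : ℂ)) y = ((bet g h (iterM g k [y]) : ℤ) : ℂ) := by
  have := sum_incT_pow g (fun y => ((bet g h [y] : ℤ) : ℂ)) k [y]
  rw [sum_bet] at this
  simpa using this

theorem bet_natAbs_le {g h : X → List X} {m : ℕ} (hgm : ∀ z, (g z).length ≤ m)
    (hhm : ∀ z, (h z).length ≤ m) (w : List X) : (bet g h w).natAbs ≤ w.length * m := by
  have h1 := length_applyM_le hgm w
  have h2 := length_applyM_le hhm w
  simp only [bet]
  omega

theorem bet_bound [Fintype X] {g h : X → List X} (hM1 : 1 ≤ Mg g)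
    (hbal : BAL g h < ⊤) (hM : Mg h ≤ (Mg g) ^ 2) (k : ℕ) (y : X) :
    (bet g h (iterM g k [y])).natAbs ≤
      2 ^ (Fintype.card X - 1) * (1 + k) ^ (Fintype.card X - 1) * Mg g ^ (Fintype.card X + 1) := by
  set v : X → ℂ := fun y => ((bet g h [y] : ℤ) : ℂ) with hv
  obtain ⟨ls, hl, hp⟩ := exists_facProd (incT g)
  rw [Module.finrank_fintype_fun_eq_card] at hl
  have hn : ∀ k y, ‖(incT g ^ k) v y‖ = ((bet g h (iterM g k [y])).natAbs : ℝ) := by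
    intro k y
    rw [hv, incT_pow_bet, Complex.norm_intCast, ← Int.cast_abs, Int.abs_eq_natAbs, Int.cast_natCast]
  have hbo : BddOrbit (incT g) v := by
    obtain ⟨B, hB⟩ := ENat.ne_top_iff_exists.1 hbal.ne
    refine ⟨B, fun k => ?_⟩
    rw [pi_norm_le_iff_of_nonneg (Nat.cast_nonneg _)]
    intro y
    rw [hn]
    have h1 : ((bet g h (iterM g k [y])).natAbs : ℕ∞) ≤ BAL g h :=
      le_iSup₂_of_le (f := fun (x : X) (k : ℕ) =>
        ((((applyM g (iterM g k [x])).length : ℤ) -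
        ((applyM h (iterM g k [x])).length : ℤ)).natAbs : ℕ∞)) y k le_rfl
    rw [← hB] at h1
    exact_mod_cast h1
  have hD : ∀ i < ls.length, ‖(incT g ^ i) v‖ ≤ ((Mg g ^ (Fintype.card X + 1) : ℕ) : ℝ) := by
    intro i hi
    rw [pi_norm_le_iff_of_nonneg (Nat.cast_nonneg _)]
    intro y
    rw [hn]
    have hMM : Mg g ≤ Mg g ^ 2 := Nat.le_self_pow (by norm_num) _
    have h1 := bet_natAbs_le (m := Mg g ^ 2) (fun z => (le_Mg g z).trans hMM)
      (fun z => (le_Mg h z).trans hM) (iterM g i [y])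
    have h2 := length_iterM_le g i [y]
    have h3 : (iterM g i [y]).length * Mg g ^ 2 ≤ Mg g ^ (Fintype.card X + 1) := by
      calc (iterM g i [y]).length * Mg g ^ 2 ≤ Mg g ^ i * Mg g ^ 2 := by
            apply Nat.mul_le_mul_right; simpa using h2
        _ = Mg g ^ (i + 2) := by rw [pow_add]
        _ ≤ _ := Nat.pow_le_pow_right hM1 (by omega)
    exact_mod_cast h1.trans h3
  have key := orbit_bound (incT g) ls v hbo (by rw [hp]; rfl) _ (Nat.cast_nonneg _) hD k
  have key2 := (norm_le_pi_norm ((incT g ^ k) v) y).trans key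
  rw [hn, hl] at key2
  exact_mod_cast key2

/-- Balance of prefixes of an image. -/
theorem bet_prefix_aux {g h f : X → List X} {D E : ℕ} (hD : ∀ z, (bet g h (f z)).natAbs ≤ D)
    (hE : ∀ z u, u <+: f z → (bet g h u).natAbs ≤ E) (w : List X) (hw : w ≠ []) :
    ∀ u, u <+: applyM f w → (bet g h u).natAbs ≤ (w.length - 1) * D + E := by
  induction w with
  | nil => exact absurd rfl hw
  | cons a w ih =>
    intro u hu
    rw [applyM_cons] at hu
    rcases List.prefix_or_prefix_of_prefix hu (List.prefix_append (f a) (applyM f w)) with h1 | h1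
    · have := hE a u h1
      omega
    · obtain ⟨t, rfl⟩ := h1
      rw [List.prefix_append_right_inj] at hu
      rw [bet_append]
      rcases eq_or_ne w [] with rfl | hw'
      · rw [applyM_nil, List.prefix_nil] at hu
        subst hu
        have h2 := hE a (f a) List.prefix_rfl
        simp only [bet, applyM_nil] at h2 ⊢
        simp only [List.length_nil]
        omega
      · have h2 := ih hw' t hu
        have h3 := hD a
        have h4 : 0 < w.length := List.length_pos_iff.2 hw'
        obtain ⟨m, hm⟩ : ∃ m, w.length = m + 1 := ⟨w.length - 1, by omega⟩
        rw [hm] at h2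
        simp only [List.length_cons, hm, Nat.add_sub_cancel] at h2 ⊢
        rw [Nat.add_mul, one_mul]
        omega

/-- Balance of prefixes of `g^k(y)`. -/
theorem bet_prefix {g h : X → List X} (hg : Primitive g) {M D : ℕ} (A : ℕ)
    (hgM : ∀ z, (g z).length ≤ M)
    (hD : ∀ k < A, ∀ z, (bet g h (iterM g k [z])).natAbs ≤ D) (hA : 0 < A) :
    ∀ k ≤ A, ∀ z u, u <+: iterM g k [z] → (bet g h u).natAbs ≤ k * ((M - 1) * D) + D := by
  intro k
  induction k with
  | zero =>
    intro _ z u hu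
    have h0 := hD 0 hA z
    rw [iterM_zero] at h0 hu
    rcases u with _ | ⟨a, u⟩
    · simp [bet, applyM_nil]
    · have : a :: u = [z] := hu.eq_of_length_le (by simp)
      rw [this]; omega
  | succ k ih =>
    intro hk z u hu
    rw [iterM_succ, applyM_single, ← applyM_powM] at hu
    have h1 := bet_prefix_aux (g := g) (h := h) (hD k (by omega)) (ih (by omega)) (g z)
      (hg.nonerasing z) u hu
    have h2 : ((g z).length - 1) * D ≤ (M - 1) * D :=
      Nat.mul_le_mul_right _ (Nat.sub_le_sub_right (hgM z) 1)
    rw [Nat.add_mul, one_mul]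
    omega

theorem pair_infix {g : X → List X} (hg : ∀ z, g z ≠ []) (a b : X) (w : List X) :
    2 ≤ w.length → [a, b] <:+: applyM g w →
    ∃ c d, [c, d] <:+: w ∧ [a, b] <:+: applyM g [c, d] := by
  induction w with
  | nil => intro h; simp at h
  | cons c w ih =>
    intro hw hab
    rcases w with _ | ⟨d, w⟩
    · simp at hw
    have e2 : applyM g [c, d] = g c ++ g d := by simp [applyM]
    have hcd : [c, d] <:+: c :: d :: w := ⟨[], w, rfl⟩
    have case1 : [a, b] <:+: g c → ∃ c' d', [c', d'] <:+: c :: d :: w ∧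
        [a, b] <:+: applyM g [c', d'] := fun h =>
      ⟨c, d, hcd, by rw [e2]; exact List.infix_append_of_infix_left h⟩
    have case2 : [a, b] <:+: applyM g (d :: w) → ∃ c' d', [c', d'] <:+: c :: d :: w ∧
        [a, b] <:+: applyM g [c', d'] := by
      intro h
      rcases w with _ | ⟨e, w⟩
      · rw [applyM_single] at h
        exact ⟨c, d, hcd, by rw [e2]; exact List.infix_append_of_infix_right h⟩
      · obtain ⟨c', d', h1, h2⟩ := ih (by simp) h
        exact ⟨c', d', h1.trans (List.infix_append_right (l₁ := [c])), h2⟩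
    rw [applyM_cons, List.infix_append_iff] at hab
    rcases hab with h | h | ⟨t1, t2, ht, h1, h2⟩
    · exact case1 h
    · exact case2 h
    · rcases t1 with _ | ⟨a', t1⟩
      · rw [List.nil_append] at ht
        exact case2 (ht ▸ h2.isInfix)
      rcases t1 with _ | ⟨b', t1⟩
      · simp only [List.cons_append, List.nil_append, List.cons.injEq] at ht
        obtain ⟨rfl, rfl⟩ := ht
        rw [applyM_cons] at h2
        have h3 : [b] <+: g d := by
          obtain ⟨b', t, hbt⟩ := List.exists_cons_of_ne_nil (hg d)
          rw [hbt] at h2 ⊢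
          simp only [List.cons_append, List.cons_prefix_cons] at h2
          obtain ⟨rfl, _⟩ := h2
          exact ⟨t, rfl⟩
        obtain ⟨u, hu⟩ := h1
        obtain ⟨v, hv⟩ := h3
        exact ⟨c, d, hcd, u, v, by rw [e2, ← hu, ← hv]; simp⟩
      · have hlen := congrArg List.length ht
        simp only [List.length_cons, List.length_append, List.length_nil] at hlen
        have ht2 : t2 = [] := List.length_eq_zero_iff.1 (by omega)
        subst ht2
        rw [List.append_nil] at ht
        exact case1 (ht ▸ h1.isInfix)

theorem iterM_prefix_succ {g : X → List X} {x : X} (hx : [x] <+: g x) (i : ℕ) :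
    iterM g i [x] <+: iterM g (i + 1) [x] := by
  rw [iterM_succ, applyM_single]
  exact iterM_prefix g i hx

theorem iterM_prefix_le {g : X → List X} {x : X} (hx : [x] <+: g x) {i j : ℕ} (hij : i ≤ j) :
    iterM g i [x] <+: iterM g j [x] := by
  induction j, hij using Nat.le_induction with
  | base => exact List.prefix_rfl
  | succ k _ ih => exact ih.trans (iterM_prefix_succ hx k)

theorem two_le_length {g : X → List X} {x : X} (hx : OmegaExists g x) : 2 ≤ (g x).length := by
  by_contra hlt
  have h1 : g x = [x] := (hx.1.eq_of_length_le (by simp; omega)).symm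
  have h2 : ∀ i, iterM g i [x] = [x] := by
    intro i
    induction i with
    | zero => rfl
    | succ i ih => rw [iterM_succ, applyM_single, h1, ih]
  obtain ⟨i, hi⟩ := (hx.2.eventually_ge_atTop 2).exists
  rw [h2] at hi
  simp at hi

/-- All pairs occur already in `g^{n²}(x)`. -/
theorem pair_stab [Fintype X] {g : X → List X} (hg : Primitive g) {x : X}
    (hx : OmegaExists g x) (i : ℕ) (a b : X) (hab : [a, b] <:+: iterM g i [x]) :
    [a, b] <:+: iterM g (Fintype.card X ^ 2) [x] := by
  classical
  let S : ℕ → Finset (X × X) := fun i =>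
    Finset.univ.filter fun p => [p.1, p.2] <:+: iterM g (i + 1) [x]
  have hS : ∀ i a b, (a, b) ∈ S i ↔ [a, b] <:+: iterM g (i + 1) [x] := by
    intro i a b; simp [S]
  have hmono : ∀ i, S i ⊆ S (i + 1) := by
    rintro i ⟨a, b⟩ h
    rw [hS] at h ⊢
    exact h.trans (iterM_prefix_succ hx.1 _).isInfix
  have hmono' : Monotone S := monotone_nat_of_le_succ hmono
  have hlen : ∀ i, 2 ≤ (iterM g (i + 1) [x]).length := by
    intro i
    refine (two_le_length hx).trans ?_
    have := length_iterM_mono hg (show 1 ≤ i + 1 by omega) [x]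
    rwa [iterM_succ g 0, iterM_zero, applyM_single] at this
  have hpos : ∀ i, 1 ≤ (S i).card := by
    intro i
    apply Finset.card_pos.2
    have := hlen i
    match hw : iterM g (i + 1) [x], this with
    | a :: b :: w, _ => exact ⟨(a, b), by rw [hS, hw]; exact ⟨[], w, rfl⟩⟩
  have hc : Fintype.card (X × X) = Fintype.card X ^ 2 := by rw [Fintype.card_prod, sq]
  have hcp : 0 < Fintype.card X ^ 2 := by
    have : Nonempty X := ⟨x⟩
    exact pow_pos Fintype.card_pos 2
  have h3 := Nat.stabilises_of_monotone (f := fun i => (S i).card - 1)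
    (b := Fintype.card X ^ 2 - 1) (n := i + (Fintype.card X ^ 2 - 1))
    (fun a b hab => Nat.sub_le_sub_right (Finset.card_le_card (hmono' hab)) 1)
    (fun m => Nat.sub_le_sub_right (hc ▸ Finset.card_le_univ _) 1)
    (by
      intro m hm
      have h1 := hpos m
      have h2 := hpos (m + 1)
      have heq : S m = S (m + 1) := Finset.eq_of_subset_of_card_le (hmono m) (by omega)
      have : S (m + 1) = S (m + 2) := by
        apply Finset.Subset.antisymm (hmono _)
        rintro ⟨a, b⟩ h
        rw [hS, iterM_succ'] at h
        obtain ⟨c, d, h1, h2⟩ := pair_infix hg.nonerasing a b _ (hlen _) h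
        rw [← hS, ← heq, hS] at h1
        rw [hS, iterM_succ']
        exact h2.trans (applyM_infix g h1)
      simp only [this])
    (by omega)
  have heq : S (Fintype.card X ^ 2 - 1) = S (i + (Fintype.card X ^ 2 - 1)) :=
    Finset.eq_of_subset_of_card_le (hmono' (by omega)) (by
      have h1 := hpos (Fintype.card X ^ 2 - 1)
      have h2 := hpos (i + (Fintype.card X ^ 2 - 1))
      omega)
  have h4 : (a, b) ∈ S (i + (Fintype.card X ^ 2 - 1)) := by
    rw [hS]
    exact hab.trans (iterM_prefix_le hx.1 (by omega)).isInfix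
  rw [← heq, hS] at h4
  rwa [show Fintype.card X ^ 2 - 1 + 1 = Fintype.card X ^ 2 by omega] at h4

/-- Pairs occur in images of every letter. -/
theorem pair_all [Fintype X] {g : X → List X} (hg : Primitive g) {x : X}
    (hx : OmegaExists g x) (i : ℕ) (a b : X) (hab : [a, b] <:+: iterM g i [x]) (z : X) :
    [a, b] <:+: iterM g (Fintype.card X ^ 2 + (Fintype.card X - 1)) [z] := by
  obtain ⟨j, hj, h⟩ := reach hg z x
  have h1 := pair_stab hg hx i a b hab
  have h2 : iterM g (Fintype.card X ^ 2 + (Fintype.card X - 1 - j)) [x] <:+: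
      iterM g (Fintype.card X ^ 2 + (Fintype.card X - 1)) [z] := by
    rw [show Fintype.card X ^ 2 + (Fintype.card X - 1)
      = Fintype.card X ^ 2 + (Fintype.card X - 1 - j) + j by omega, iterM_add _ _ j]
    exact iterM_infix _ _ (single_infix h)
  exact (h1.trans (iterM_prefix_le hx.1 (by omega)).isInfix).trans h2

/-- Segment of an infinite word. -/
def seg (s : ℕ → X) (p L : ℕ) : List X := (List.range L).map fun i => s (p + i)

@[simp] theorem seg_length (s : ℕ → X) (p L : ℕ) : (seg s p L).length = L := by simp [seg]

theorem seg_getElem (s : ℕ → X) (p L i : ℕ) (h : i < (seg s p L).length) :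
    (seg s p L)[i] = s (p + i) := by simp [seg]

theorem seg_append (s : ℕ → X) (p a b : ℕ) :
    seg s p (a + b) = seg s p a ++ seg s (p + a) b := by
  simp [seg, List.range_add, add_assoc, Function.comp_def]

theorem seg_one (s : ℕ → X) (p : ℕ) : seg s p 1 = [s p] := by simp [seg]

theorem seg_two (s : ℕ → X) (p : ℕ) : seg s p 2 = [s p, s (p + 1)] := by
  simp [seg, List.range_succ]

theorem seg_eq_iff (s t : ℕ → X) (p q L : ℕ) :
    seg s p L = seg t q L ↔ ∀ i < L, s (p + i) = t (q + i) := by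
  simp [seg]

theorem seg_infix (s : ℕ → X) {p L q L' : ℕ} (h1 : p ≤ q) (h2 : q + L' ≤ p + L) :
    seg s q L' <:+: seg s p L := by
  refine ⟨seg s p (q - p), seg s (q + L') (p + L - (q + L')), ?_⟩
  have e1 := seg_append s p (q - p) L'
  have e2 := seg_append s p (q - p + L') (p + L - (q + L'))
  rw [show p + (q - p) = q by omega] at e1
  rw [show p + (q - p + L') = q + L' by omega,
    show q - p + L' + (p + L - (q + L')) = L by omega, e1] at e2
  exact e2.symm

theorem infix_seg (s : ℕ → X) {p L : ℕ} {v : List X} (h : v <:+: seg s p L) :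
    ∃ q, p ≤ q ∧ q + v.length ≤ p + L ∧ v = seg s q v.length := by
  obtain ⟨a, b, hab⟩ := h
  have hl := congrArg List.length hab
  simp only [List.length_append, seg_length] at hl
  refine ⟨p + a.length, by omega, by omega, ?_⟩
  have e2 := seg_append s p (a.length + v.length) b.length
  rw [hl, ← hab, seg_append s p a.length] at e2
  have h1 := List.append_inj_left e2 (by simp)
  exact List.append_inj_right h1 (by simp)

theorem prefix_seg (s : ℕ → X) {L : ℕ} {v : List X} (h : v <+: seg s 0 L) :
    v = seg s 0 v.length := by
  obtain ⟨b, hab⟩ := h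
  have hl := congrArg List.length hab
  simp only [List.length_append, seg_length] at hl
  have e2 := seg_append s 0 v.length b.length
  rw [hl, ← hab] at e2
  exact List.append_inj_left e2 (by simp)

theorem isPrefI_iff (w : List X) (s : ℕ → X) : IsPrefI w s ↔ w = seg s 0 w.length := by
  constructor
  · intro h
    apply List.ext_getElem (by simp)
    intro i h1 h2
    rw [seg_getElem, zero_add]
    exact h i h1
  · intro h i hi
    have : w[i] = (seg s 0 w.length)[i]'(by simpa using hi) := by
      congr 1
    rw [this, seg_getElem, zero_add]

theorem seg_prefix (s : ℕ → X) {a b : ℕ} (h : a ≤ b) : seg s 0 a <+: seg s 0 b := by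
  refine ⟨seg s (0 + a) (b - a), ?_⟩
  rw [← seg_append, show a + (b - a) = b by omega]

/-- Position of the image of the `i`-th letter. -/
def pos (f : X → List X) (s : ℕ → X) (i : ℕ) : ℕ := (applyM f (seg s 0 i)).length

theorem pos_zero (f : X → List X) (s : ℕ → X) : pos f s 0 = 0 := by
  simp [pos, seg, applyM]

theorem pos_add (f : X → List X) (s : ℕ → X) (i L : ℕ) :
    pos f s (i + L) = pos f s i + (applyM f (seg s i L)).length := by
  simp [pos, seg_append, applyM_append]

theorem pos_succ (f : X → List X) (s : ℕ → X) (i : ℕ) :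
    pos f s (i + 1) = pos f s i + (f (s i)).length := by
  rw [pos_add, seg_one, applyM_single]

theorem pos_add_ge {f : X → List X} {l : ℕ} (hf : ∀ z, l ≤ (f z).length) (s : ℕ → X)
    (i L : ℕ) : pos f s i + L * l ≤ pos f s (i + L) := by
  have := length_applyM_ge hf (seg s i L)
  rw [seg_length] at this
  rw [pos_add]; omega

theorem pos_add_le {f : X → List X} {l : ℕ} (hf : ∀ z, (f z).length ≤ l) (s : ℕ → X)
    (i L : ℕ) : pos f s (i + L) ≤ pos f s i + L * l := by
  have := length_applyM_le hf (seg s i L)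
  rw [seg_length] at this
  rw [pos_add]; omega

theorem pos_locate {f : X → List X} (hf : ∀ z, 1 ≤ (f z).length) (s : ℕ → X) (p : ℕ) :
    ∃ q, pos f s q ≤ p ∧ p < pos f s (q + 1) := by
  induction p with
  | zero => exact ⟨0, by rw [pos_zero], by rw [pos_succ]; have := hf (s 0); omega⟩
  | succ p ih =>
    obtain ⟨q, h1, h2⟩ := ih
    by_cases h : p + 1 < pos f s (q + 1)
    · exact ⟨q, by omega, h⟩
    · refine ⟨q + 1, by omega, ?_⟩
      rw [pos_succ f s (q + 1)]
      have := hf (s (q + 1))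
      omega

/-- `s` is fixed by `f`. -/
def FixW (f : X → List X) (s : ℕ → X) : Prop :=
  ∀ i, applyM f (seg s 0 i) = seg s 0 (pos f s i)

theorem FixW.seg {f : X → List X} {s : ℕ → X} (h : FixW f s) (i L : ℕ) :
    applyM f (seg s i L) = _root_.seg s (pos f s i) (applyM f (_root_.seg s i L)).length := by
  have h1 := h (i + L)
  rw [pos_add, seg_append, seg_append, applyM_append, h i, zero_add, zero_add] at h1
  exact List.append_inj_right h1 rfl

theorem omega_seg {g : X → List X} {x : X} {s : ℕ → X} (hs : IsOmega g x s) (k : ℕ) :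
    iterM g k [x] = seg s 0 (iterM g k [x]).length := (isPrefI_iff _ _).1 (hs.2 k)

theorem omega_fix {g : X → List X} {x : X} {s : ℕ → X} (hs : IsOmega g x s) (k : ℕ) :
    FixW (powM g k) s := by
  intro i
  obtain ⟨j, hj⟩ := (hs.1.2.eventually_ge_atTop i).exists
  have h1 : seg s 0 i <+: iterM g j [x] := by
    rw [omega_seg hs j]; exact seg_prefix s hj
  have h2 := iterM_prefix g k h1
  rw [← iterM_add, omega_seg hs (k + j), ← applyM_powM] at h2
  exact prefix_seg s h2

theorem powM_one (g : X → List X) : powM g 1 = g := by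
  funext a
  rw [powM, iterM_succ, applyM_single, iterM_zero]

theorem infix_all [Fintype X] {g : X → List X} (hg : Primitive g) {x : X} {s : ℕ → X}
    (hs : IsOmega g x s) {k l : ℕ} (hl1 : 1 ≤ l) (hl : ∀ z, l ≤ (iterM g k [z]).length)
    (p L : ℕ) (hL : L ≤ l + 1) (z : X) :
    seg s p L <:+: iterM g (k + (Fintype.card X ^ 2 + (Fintype.card X - 1))) [z] := by
  have hf := omega_fix hs k
  obtain ⟨q, h1, h2⟩ := pos_locate (f := powM g k) (fun z => hl1.trans (hl z)) s p
  have h3 : seg s p L <:+: applyM (powM g k) (seg s q 2) := by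
    rw [hf.seg q 2]
    apply seg_infix s h1
    rw [← pos_add, show q + 2 = (q + 1) + 1 by ring, pos_succ]
    have : l ≤ (powM g k (s (q + 1))).length := hl _
    omega
  rw [applyM_powM] at h3
  rw [iterM_add g k]
  refine h3.trans (iterM_infix g k ?_)
  rw [seg_two]
  obtain ⟨j, hj⟩ := (hs.1.2.eventually_ge_atTop (q + 2)).exists
  refine pair_all hg hs.1 j _ _ ?_ z
  rw [← seg_two, omega_seg hs j]
  exact seg_infix s (Nat.zero_le _) (by omega)

theorem recur [Fintype X] {g : X → List X} (hg : Primitive g) {x : X} {s : ℕ → X}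
    (hs : IsOmega g x s) {k l mx : ℕ} (hl1 : 1 ≤ l) (hl : ∀ z, l ≤ (iterM g k [z]).length)
    (hmx : ∀ z, (iterM g (k + (Fintype.card X ^ 2 + (Fintype.card X - 1))) [z]).length ≤ mx)
    (p L : ℕ) (hL : L ≤ l + 1) (p' : ℕ) :
    ∃ u, p' ≤ u ∧ u + L ≤ p' + 2 * mx ∧ seg s u L = seg s p L := by
  set K := k + (Fintype.card X ^ 2 + (Fintype.card X - 1)) with hK
  have hf := omega_fix hs K
  have h1K : ∀ z, 1 ≤ (powM g K z).length := fun z =>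
    (hl1.trans (hl z)).trans (length_iterM_mono hg (by omega) [z])
  have hmx' : ∀ z, (powM g K z).length ≤ mx := hmx
  obtain ⟨q, h1, h2⟩ := pos_locate h1K s p'
  have h3 := infix_all hg hs hl1 hl p L hL (s (q + 1))
  have h4 : iterM g K [s (q + 1)] = applyM (powM g K) (seg s (q + 1) 1) := by
    rw [applyM_powM, seg_one]
  rw [← hK, h4, hf.seg] at h3
  obtain ⟨u, hu1, hu2, hu3⟩ := infix_seg s h3
  rw [seg_length] at hu2 hu3
  rw [← pos_add, pos_succ, pos_succ] at hu2
  have := hmx' (s q)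
  have := hmx' (s (q + 1))
  exact ⟨u, by omega, by omega, hu3.symm⟩

/-- A period valid on a long window gives looping. -/
theorem looping_of_period {g : X → List X} {x : X} {s : ℕ → X} (hs : IsOmega g x s)
    {e : ℕ} (he : 0 < e) (hp : ∀ p, s p = s (p + e)) : Looping g := by
  refine ⟨1, one_pos, x, seg s 0 e, s, by rw [powM_one]; exact hs, ?_, ?_⟩
  · intro h
    have := congrArg List.length h
    simp at this
    omega
  · intro i hi
    rw [seg_getElem, seg_length, zero_add]
    have : ∀ m j, s (j + e * m) = s j := by
      intro m
      induction m with
      | zero => simp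
      | succ m ih => intro j; rw [Nat.mul_succ, ← add_assoc, ← hp, ih]
    conv_lhs => rw [← Nat.mod_add_div i e]
    exact this _ _

/-- The image of the `i`-th letter under `f` agrees with `s`. -/
def Agr (f : X → List X) (s : ℕ → X) (i : ℕ) : Prop :=
  f (s i) = seg s (pos f s i) (f (s i)).length

theorem agr_seg {f : X → List X} {s : ℕ → X} {i W : ℕ} (h : ∀ t < W, Agr f s (i + t)) :
    applyM f (seg s i W) = seg s (pos f s i) (applyM f (seg s i W)).length := by
  induction W with
  | zero => simp [seg, applyM]
  | succ W ih =>
    have h1 := ih fun t ht => h t (by omega)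
    have h2 := h W (by omega)
    rw [Agr, pos_add] at h2
    rw [seg_append, seg_one, applyM_append, applyM_single, List.length_append, seg_append,
      ← h1, ← h2]

theorem FixW.agr {f : X → List X} {s : ℕ → X} (h : FixW f s) (i : ℕ) : Agr f s i := by
  have := h.seg i 1
  rwa [seg_one, applyM_single] at this

theorem agr_window {f : X → List X} (hf : ∀ z, 1 ≤ (f z).length) {s : ℕ → X} {i j W : ℕ}
    (hi : ∀ t < W, Agr f s (i + t)) (hj : ∀ t < W, Agr f s (j + t))
    (hw : seg s i W = seg s j W) :
    ∀ r < W, s (pos f s i + r) = s (pos f s j + r) := by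
  have h1 := agr_seg hi
  have h2 := agr_seg hj
  rw [← hw] at h2
  rw [h1, seg_length] at h2
  have h3 := (seg_eq_iff _ _ _ _ _).1 h2
  intro r hr
  apply h3
  have := length_applyM_ge hf (seg s i W)
  rw [seg_length] at this
  omega

theorem core {g h : X → List X} (hg : Primitive g) (hh : Primitive h) {x : X} {s : ℕ → X}
    (hs : IsOmega g x s) (hlf : LoopFree g) {Δ V W N Mh : ℕ}
    (hMh : ∀ z, (h z).length ≤ Mh)
    (hδ : ∀ i ≤ N, pos g s i ≤ pos h s i + Δ ∧ pos h s i ≤ pos g s i + Δ)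
    (hrec : ∀ p L p', L ≤ 2 * Δ + 1 → ∃ u, p' ≤ u ∧ u + L ≤ p' + V ∧ seg s u L = seg s p L)
    (hearly : ∀ p, ∃ u, u + (W + 1) + Δ ≤ N ∧ seg s u (W + 1) = seg s p (W + 1))
    (hW : W = V + 2 * Δ) (hW2 : (Δ + 1) * Mh + Δ ≤ W) (hN : W + 2 * Δ ≤ N)
    (hagr : ∀ i < N, pos h s (i + 1) ≤ pos g s N → Agr h s i) :
    ∀ i, Agr h s i := by
  have hfix : FixW g s := by have := omega_fix hs 1; rwa [powM_one] at this
  have hgag : ∀ i, Agr g s i := hfix.agr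
  have gmono : ∀ i L, pos g s i + L ≤ pos g s (i + L) := fun i L => by
    have := pos_add_ge hg.one_le s i L; omega
  have hmono : ∀ i L, pos h s i + L ≤ pos h s (i + L) := fun i L => by
    have := pos_add_ge hh.one_le s i L; omega
  -- early blocks agree
  have early : ∀ i, i + W + Δ ≤ N → ∀ t < W, Agr h s (i + t) := by
    intro i hi t ht
    apply hagr _ (by omega)
    have h1 := hmono (i + t + 1) (W - (t + 1))
    rw [show i + t + 1 + (W - (t + 1)) = i + W by omega] at h1
    have h2 := (hδ (i + W) (by omega)).2
    have h3 := gmono (i + W) (N - (i + W))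
    rw [show i + W + (N - (i + W)) = N by omega] at h3
    omega
  have stage1' : ∀ i j, i + W + Δ ≤ N → j + W + Δ ≤ N → seg s i W = seg s j W →
      ¬ pos g s j + pos h s i < pos g s i + pos h s j := by
    intro i j hi hj hw hlt
    have G := agr_window hg.one_le (fun t _ => hgag (i + t)) (fun t _ => hgag (j + t)) hw
    have H := agr_window hh.one_le (early i hi) (early j hj) hw
    obtain ⟨hi1, hi2⟩ := hδ i (by omega)
    obtain ⟨hj1, hj2⟩ := hδ j (by omega)
    obtain ⟨e, he⟩ : ∃ e, pos g s i + pos h s j = pos g s j + pos h s i + e :=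
      ⟨_, (Nat.add_sub_cancel' hlt.le).symm⟩
    refine hlf (looping_of_period hs (e := e) (by omega) fun p => ?_)
    obtain ⟨u', hu1, hu2, hu3⟩ := hrec p (e + 1) (pos g s i + Δ) (by omega)
    have hu4 := (seg_eq_iff _ _ _ _ _).1 hu3
    have e1 := hu4 0 (by omega)
    have e2 := hu4 e (by omega)
    rw [add_zero, add_zero] at e1
    rw [← e1, ← e2]
    have e3 := H (u' - pos h s i) (by omega)
    have e4 := G (u' - pos g s i + e) (by omega)
    rw [show pos h s i + (u' - pos h s i) = u' by omega] at e3
    rw [show pos g s i + (u' - pos g s i + e) = u' + e by omega] at e4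
    rw [e3, e4]
    congr 1
    omega
  have stage1 : ∀ i j, i + W + Δ ≤ N → j + W + Δ ≤ N → seg s i W = seg s j W →
      pos g s i + pos h s j = pos g s j + pos h s i := by
    intro i j hi hj hw
    have h1 := stage1' i j hi hj hw
    have h2 := stage1' j i hj hi hw.symm
    omega
  have trunc : ∀ i j, seg s i (W + 1) = seg s j (W + 1) → seg s i W = seg s j W ∧
      s i = s j ∧ seg s (i + 1) W = seg s (j + 1) W := by
    intro i j hij
    have hij' := (seg_eq_iff _ _ _ _ _).1 hij
    refine ⟨(seg_eq_iff _ _ _ _ _).2 fun t ht => hij' t (by omega), hij' 0 (by omega),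
      (seg_eq_iff _ _ _ _ _).2 fun t ht => ?_⟩
    have := hij' (t + 1) (by omega)
    rwa [show i + (t + 1) = i + 1 + t by ring, show j + (t + 1) = j + 1 + t by ring] at this
  have stage2 : ∀ i j, j + W + Δ ≤ N → seg s i W = seg s j W →
      pos g s i + pos h s j = pos g s j + pos h s i := by
    intro i
    induction i with
    | zero => intro j hj hw; exact stage1 0 j (by omega) hj hw
    | succ i ih =>
      intro j hj hw
      obtain ⟨u, hu1, hu2⟩ := hearly i
      obtain ⟨t1, t2, t3⟩ := trunc _ _ hu2
      have h1 := ih u (by omega) t1.symm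
      have h2 := stage1 (u + 1) j (by omega) hj (t3.trans hw)
      rw [pos_succ, pos_succ, t2] at h2
      rw [pos_succ, pos_succ]
      omega
  intro i
  by_cases hiΔ : i < Δ
  · have hW0 : 0 < W := by
      by_contra h0
      have hz : W = 0 := by omega
      have := hh.one_le (s 0)
      have := hMh (s 0)
      have : 0 < (Δ + 1) * Mh := Nat.mul_pos (by omega) (by omega)
      omega
    exact early i (by omega) 0 hW0
  · obtain ⟨i0, rfl⟩ : ∃ i0, i = i0 + Δ := ⟨i - Δ, by omega⟩
    obtain ⟨j, hj1, hj2⟩ := hearly i0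
    obtain ⟨t1, -, -⟩ := trunc _ _ hj2
    have hd := stage2 i0 j (by omega) t1.symm
    have hMh1 : 1 ≤ Mh := (hh.one_le (s 0)).trans (hMh (s 0))
    have hΔW : Δ < W := by
      have : Δ + 1 ≤ (Δ + 1) * Mh := Nat.le_mul_of_pos_right _ (by omega)
      omega
    have hag := early j (by omega) Δ hΔW
    have hsj : s (j + Δ) = s (i0 + Δ) := (seg_eq_iff _ _ _ _ _).1 t1 Δ hΔW
    have hpre : seg s j Δ = seg s i0 Δ :=
      (seg_eq_iff _ _ _ _ _).2 fun t ht => (seg_eq_iff _ _ _ _ _).1 t1 t (by omega)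
    have G := agr_window hg.one_le (fun t _ => hgag (i0 + t)) (fun t _ => hgag (j + t)) t1.symm
    rw [Agr, hsj] at hag
    rw [Agr]
    conv_lhs => rw [hag]
    rw [seg_eq_iff]
    intro r hr
    have hlen := length_applyM_le hMh (seg s i0 Δ)
    have hlen2 := length_applyM_ge hh.one_le (seg s i0 Δ)
    rw [seg_length] at hlen hlen2
    obtain ⟨hj3, hj4⟩ := hδ j (by omega)
    have hr2 := hMh (s (i0 + Δ))
    rw [Nat.add_mul, one_mul] at hW2
    rw [pos_add, pos_add, hpre]
    have := G (pos h s i0 + (applyM h (seg s i0 Δ)).length + r - pos g s i0) (by omega)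
    rw [show pos g s i0 + (pos h s i0 + (applyM h (seg s i0 Δ)).length + r - pos g s i0)
      = pos h s i0 + (applyM h (seg s i0 Δ)).length + r by omega] at this
    rw [this]
    congr 1
    omega

theorem omega_eq {h : X → List X} {x : X} {s sh : ℕ → X} (hx : s 0 = x)
    (hsh : IsOmega h x sh) (hag : ∀ i, Agr h s i) : s = sh := by
  have h1 : ∀ k, iterM h k [x] = seg s 0 (iterM h k [x]).length := by
    intro k
    induction k with
    | zero => rw [iterM_zero, List.length_singleton, seg_one, hx]
    | succ k ih =>
      have := agr_seg (f := h) (s := s) (i := 0) (W := (iterM h k [x]).length) fun t _ => hag _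
      rw [pos_zero, ← ih, ← iterM_succ'] at this
      exact this
  funext i
  obtain ⟨k, hk⟩ := (hsh.1.2.eventually_ge_atTop (i + 1)).exists
  have h2 := h1 k
  rw [omega_seg hsh k, seg_length, seg_eq_iff] at h2
  have := h2 i (by omega)
  simpa using this.symm

/-- From comparability to agreement of the early blocks. -/
theorem agr_of_comp {g h : X → List X} {s : ℕ → X} {N : ℕ} (hfix : FixW g s)
    (hc : seg s 0 N ∈ COMP g h) : ∀ i < N, pos h s (i + 1) ≤ pos g s N → Agr h s i := by
  obtain ⟨u₁, u₂, hu⟩ := hc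
  intro i hi hp
  rw [hfix N] at hu
  have h1 : applyM h (seg s 0 (i + 1)) <+: seg s 0 (pos g s N) := by
    have h2 : applyM h (seg s 0 (i + 1)) <+: seg s 0 (pos g s N) ++ u₁ := by
      rw [hu]
      exact (applyM_prefix h (seg_prefix s (by omega))).trans (List.prefix_append _ _)
    refine List.prefix_of_prefix_length_le h2 (List.prefix_append _ _) ?_
    rw [seg_length]; exact hp
  have h3 := prefix_seg s h1
  rw [seg_append, zero_add, seg_one, applyM_append, applyM_single, List.length_append,
    seg_append, zero_add] at h3
  exact List.append_inj_right h3 (by simp)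

theorem comp_of_eq {g h : X → List X} {x : X} {s : ℕ → X} (hg : IsOmega g x s)
    (hh : IsOmega h x s) (N : ℕ) : seg s 0 N ∈ COMP g h := by
  have h1 : FixW g s := by have := omega_fix hg 1; rwa [powM_one] at this
  have h2 : FixW h s := by have := omega_fix hh 1; rwa [powM_one] at this
  rw [COMP, Set.mem_ofPred_eq, h1 N, h2 N]
  rcases le_total (pos g s N) (pos h s N) with hle | hle
  · obtain ⟨t, ht⟩ := seg_prefix s hle
    exact ⟨t, [], by rw [ht, List.append_nil]⟩
  · obtain ⟨t, ht⟩ := seg_prefix s hle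
    exact ⟨[], t, by rw [ht, List.append_nil]⟩

theorem Abound_ge (n : ℕ) (hn : 2 ≤ n) : 10 * n ^ 3 ≤ Abound n := by
  apply Nat.le_floor
  push_cast
  have hn' : (2 : ℝ) ≤ n := by exact_mod_cast hn
  have h1 : Real.log 2 ≤ Real.log n := Real.log_le_log (by norm_num) hn'
  have h2 := Real.log_two_gt_d9
  have h3 : (10 / 9 : ℝ) ≤ Real.sqrt (n * Real.log n) := by
    apply Real.le_sqrt_of_sq_le
    nlinarith
  have h4 : (0 : ℝ) ≤ (n : ℝ) ^ 3 := by positivity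
  nlinarith

theorem ten_cube_le (n : ℕ) (hn : 2 ≤ n) : 10 * n ^ 3 ≤ 2 ^ (3 * n + 1) := by
  induction n, hn using Nat.le_induction with
  | base => norm_num
  | succ n hn ih =>
    have h1 : (n + 1) ^ 3 ≤ (2 * n) ^ 3 := Nat.pow_le_pow_left (by omega) 3
    have h2 : 2 ^ (3 * (n + 1) + 1) = 8 * 2 ^ (3 * n + 1) := by ring
    have h3 : (2 * n) ^ 3 = 8 * n ^ 3 := by ring
    omega

theorem delta_le {n M A : ℕ} (hn : 2 ≤ n) (hM : 2 ≤ M) (hA : A = 10 * n ^ 3) :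
    2 * (A * M * (2 ^ (n - 1) * A ^ (n - 1) * M ^ (n + 1))) ≤ M ^ (3 * n ^ 2 + 3 * n + 2) := by
  obtain ⟨m, rfl⟩ : ∃ m, n = m + 1 := ⟨n - 1, by omega⟩
  have h1 : A ≤ M ^ (3 * (m + 1) + 1) := by
    rw [hA]; exact (ten_cube_le _ hn).trans (Nat.pow_le_pow_left hM _)
  have h2 : A ^ (m + 1) ≤ (M ^ (3 * (m + 1) + 1)) ^ (m + 1) := Nat.pow_le_pow_left h1 _
  have h3 : 2 ^ (m + 1) ≤ M ^ (m + 1) := Nat.pow_le_pow_left hM _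
  calc 2 * (A * M * (2 ^ (m + 1 - 1) * A ^ (m + 1 - 1) * M ^ (m + 1 + 1)))
      = 2 ^ (m + 1) * A ^ (m + 1) * M ^ (m + 1 + 2) := by
        rw [Nat.add_sub_cancel]; ring
    _ ≤ M ^ (m + 1) * (M ^ (3 * (m + 1) + 1)) ^ (m + 1) * M ^ (m + 1 + 2) := by gcongr
    _ = M ^ (3 * (m + 1) ^ 2 + 3 * (m + 1) + 2) := by
        rw [← pow_mul, ← pow_add, ← pow_add]; congr 1; ring

theorem arith_k {n : ℕ} (hn : 2 ≤ n) :
    n * (3 * n ^ 2 + 3 * n + 2) + (n ^ 2 + (n - 1)) + (n - 1) + n * 2 + (n ^ 2 + (n - 1)) + 1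
      ≤ 10 * n ^ 3 := by
  obtain ⟨m, rfl⟩ : ∃ m, n = m + 2 := ⟨n - 2, by omega⟩
  have e : m + 2 - 1 = m + 1 := by omega
  rw [e]
  ring_nf
  nlinarith [Nat.zero_le (m ^ 2), Nat.zero_le (m ^ 3)]

theorem arith_a {n : ℕ} (hn : 2 ≤ n) : n * 2 ≤ n ^ 2 + (n - 1) := by
  have : n * 2 ≤ n ^ 2 := by rw [sq]; exact Nat.mul_le_mul_left _ hn
  omega

theorem arith_b {M : ℕ} (hM : 2 ≤ M) : 4 ≤ M ^ 2 := by
  have := Nat.mul_le_mul hM hM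
  rw [sq]; omega

theorem arith_c {q d m : ℕ} (hq : 4 ≤ q) (h : q * (2 * d) ≤ m) : 8 * d ≤ m := by
  have := Nat.mul_le_mul_right (2 * d) hq
  omega

theorem arith_d {q d : ℕ} (hd : 0 < d) : (d + 1) * q ≤ q * (2 * d) := by
  rw [mul_comm]
  exact Nat.mul_le_mul_left _ (by omega)

theorem arith_e {A M D : ℕ} (hA : 0 < A) (hM : 2 ≤ M) : A * ((M - 1) * D) + D ≤ A * M * D := by
  obtain ⟨m, rfl⟩ : ∃ m, M = m + 1 := ⟨M - 1, by omega⟩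
  rw [Nat.add_sub_cancel]
  have : 1 * D ≤ A * D := Nat.mul_le_mul_right _ hA
  have e : A * (m + 1) * D = A * (m * D) + A * D := by ring
  omega

set_option maxHeartbeats 1000000 in
theorem hard_direction [Fintype X] {g h : X → List X} (hg : Primitive g) (hh : Primitive h)
    {x : X} {s sh : ℕ → X} (hs : IsOmega g x s) (hsh : IsOmega h x sh)
    (hlf : LoopFree g) (hbal : BAL g h < ⊤) (hM : Mg h ≤ (Mg g) ^ 2)
    {n A : ℕ} (hn : n = Fintype.card X) (hn2 : 2 ≤ n) (hA : A = 10 * n ^ 3)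
    (hc : iterM g A [x] ∈ COMP g h) : s = sh := by
  have hx0 : s 0 = x := by
    have := omega_seg hs 0
    rw [iterM_zero, List.length_singleton, seg_one] at this
    simpa using this.symm
  refine omega_eq hx0 hsh ?_
  have hfix : FixW g s := by have := omega_fix hs 1; rwa [powM_one] at this
  have hM2 : 2 ≤ Mg g := (two_le_length hs.1).trans (le_Mg g x)
  have hdl := delta_le hn2 hM2 hA
  have hA0 : 0 < A := by rw [hA]; positivity
  set M := Mg g with hMdef
  set D := 2 ^ (n - 1) * A ^ (n - 1) * M ^ (n + 1) with hD
  set Δ := A * M * D with hΔ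
  have hDpos : 0 < D := by rw [hD]; positivity
  have hΔpos : 0 < Δ := by rw [hΔ]; positivity
  set N := (iterM g A [x]).length with hN
  have hseg : iterM g A [x] = seg s 0 N := omega_seg hs A
  rw [hseg] at hc
  -- balance bound
  have hb : ∀ k < A, ∀ z, (bet g h (iterM g k [z])).natAbs ≤ D := by
    intro k hk z
    refine (bet_bound (by omega) hbal hM k z).trans ?_
    rw [← hn, hD]
    gcongr
    omega
  have hδ : ∀ i ≤ N, pos g s i ≤ pos h s i + Δ ∧ pos h s i ≤ pos g s i + Δ := by
    intro i hi
    have h1 := bet_prefix hg A (le_Mg g) hb hA0 A le_rfl x (seg s 0 i)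
      (by rw [hseg]; exact seg_prefix s hi)
    have h2 : A * ((M - 1) * D) + D ≤ Δ := arith_e hA0 hM2
    have h3 := h1.trans h2
    simp only [bet] at h3
    simp only [pos]
    omega
  -- growth parameters
  clear_value Δ
  clear hb hΔ hDpos
  clear_value D
  set k1 := n * (3 * n ^ 2 + 3 * n + 2) with hk1
  set k2 := n ^ 2 + (n - 1) with hk2
  have hl1 : ∀ z, 2 * Δ ≤ (iterM g k1 [z]).length := by
    intro z
    have := growth_mul hg (k := 0) (l := 1) (fun z => by simp [iterM_zero])
      (3 * n ^ 2 + 3 * n + 2) z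
    rw [mul_one, zero_add, ← hn] at this
    exact hdl.trans this
  set mx := Mg (powM g (k1 + k2)) with hmx
  have hmxle : ∀ z, (iterM g (k1 + k2) [z]).length ≤ mx := fun z => le_Mg (powM g (k1 + k2)) z
  have hmx2 : M ^ 2 * (2 * Δ) ≤ mx := by
    have h1 := growth_mul hg hl1 2 x
    rw [← hn] at h1
    refine (h1.trans (length_iterM_mono hg ?_ [x])).trans (hmxle x)
    have : n * 2 ≤ n ^ 2 + (n - 1) := arith_a hn2
    omega
  have hM4 : 4 ≤ M ^ 2 := arith_b hM2
  have hmx3 : 8 * Δ ≤ mx := arith_c hM4 hmx2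
  have hmx4 : ∀ z, mx ≤ (iterM g (k1 + k2 + (n - 1)) [z]).length := by
    intro z
    apply Finset.sup_le
    intro y _
    rw [hn]
    exact length_cmp hg (k1 + k2) z y
  set k3 := k1 + k2 + (n - 1) + n * 2 with hk3
  set V := 2 * mx with hV
  set W := V + 2 * Δ with hW
  have hl3 : ∀ z, W + 2 * Δ ≤ (iterM g k3 [z]).length := by
    intro z
    have h1 := growth_mul hg hmx4 2 z
    rw [← hn, ← hMdef] at h1
    refine le_trans ?_ h1
    have : 4 * mx ≤ M ^ 2 * mx := Nat.mul_le_mul_right _ hM4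
    omega
  have hAk : k3 + k2 + 1 ≤ A := by rw [hA]; exact arith_k hn2
  have hNbig : (iterM g (k3 + k2) [x]).length + (W + 2 * Δ) ≤ N := by
    refine le_trans ?_ (length_iterM_mono hg hAk [x])
    rw [iterM_succ, applyM_single]
    obtain ⟨t, ht⟩ := hs.1.1
    have ht2 := two_le_length hs.1
    rw [← ht] at ht2 ⊢
    rcases t with _ | ⟨y, t⟩
    · simp at ht2
    rw [iterM_append, List.length_append, show y :: t = [y] ++ t from rfl, iterM_append,
      List.length_append]
    have h1 := hl3 y
    have h2 := length_iterM_mono hg (show k3 ≤ k3 + k2 by omega) [y]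
    omega
  refine core hg hh hs hlf (Δ := Δ) (V := V) (W := W) (N := N) (Mh := M ^ 2)
    (fun z => (le_Mg h z).trans hM) hδ ?_ ?_ rfl ?_ (by omega) (agr_of_comp hfix hc)
  · intro p L p' hL
    refine recur hg hs (k := k1) (l := 2 * Δ) (mx := mx) (by omega) hl1 ?_ p L hL p'
    rw [← hn]; exact hmxle
  · intro p
    have h1 := infix_all hg hs (k := k3) (l := W + 2 * Δ) (by omega) hl3 p (W + 1) (by omega) x
    rw [← hn, ← hk2, omega_seg hs (k3 + k2)] at h1
    obtain ⟨u, -, hu2, hu3⟩ := infix_seg s h1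
    rw [seg_length] at hu2 hu3
    exact ⟨u, by omega, hu3.symm⟩
  · have : (Δ + 1) * M ^ 2 ≤ M ^ 2 * (2 * Δ) := arith_d hΔpos
    omega

/-- (Lemma 13 of the paper.) Let `g, h` be primitive, `g`
loop-free, `BAL(g,h) < ∞` and `M_h ≤ M_g²`.  Then `g^ω(x) = h^ω(x)` iff
`g^{A(n)}(x) ∈ COMP(g,h)`, where `A(n) = ⌊9n³√(n log n)⌋`. -/
theorem loopFree_equality_criterion {X : Type*} [Fintype X]
    (n : ℕ) (hn : n = Fintype.card X) (hn2 : 2 ≤ n)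
    (g h : X → List X) (hg : Primitive g) (hh : Primitive h)
    (x : X) (sg sh : ℕ → X) (hsg : IsOmega g x sg) (hsh : IsOmega h x sh)
    (hlf : LoopFree g) (hbal : BAL g h < ⊤) (hM : Mg h ≤ (Mg g) ^ 2) :
    sg = sh ↔ iterM g (Abound n) [x] ∈ COMP g h := by
  constructor
  · rintro rfl
    rw [omega_seg hsg]
    exact comp_of_eq hsg hsh _
  · intro hc
    refine hard_direction hg hh hsg hsh hlf hbal hM hn hn2 rfl ?_
    obtain ⟨u₁, u₂, hu⟩ := hc
    have hp := iterM_prefix_le hsg.1.1 (Abound_ge n hn2)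
    obtain ⟨t, ht⟩ := hp
    rw [← ht, applyM_append, applyM_append, List.append_assoc, List.append_assoc] at hu
    exact ⟨_, _, hu⟩
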